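/- (Sharp level-set bound from decoupling.) Let P = {(ω, ω²) : |ω| ≤ 1} ⊂ ℝ², let Ω be the N^{−2}-neighborhood of P decomposed into the N pieces θ_j = Ω ∩ {|ω_1 − j/N| ≤ 1/(2N)}, and let f : ℝ² → ℂ be a Schwartz function with Fourier support in Ω, so f = ∑_j f_{θ_j}. Suppose ‖f_{θ_j}‖_{L^∞(ℝ²)} ≤ 1 for every j. Then for every ε > 0 there is a constant C_ε (independent of N and f) such that the set {x ∈ B_{N²} : |f(x)| > N/10} has Lebesgue measure at most C_ε N^{1+ε}, where B_{N²} is any ball of radius N² in ℝ². -/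

import Mathlib

open MeasureTheory

/-- The Fourier transform of a Schwartz function on the Euclidean plane. -/
noncomputable def fourierTransformE (f : SchwartzMap (EuclideanSpace ℝ (Fin 2)) ℂ)
    (ω : ℝ × ℝ) : ℂ :=
  ∫ x : EuclideanSpace ℝ (Fin 2),
    f x * Complex.exp (-(2 * Real.pi * Complex.I) * ((ω.1 * x 0 + ω.2 * x 1 : ℝ) : ℂ))

/-- The `N⁻²`-neighborhood `Ω` of the truncated parabola `P = {(t, t²) : |t| ≤ 1}`. -/
def parabolaNbhd (N : ℕ) : Set (ℝ × ℝ) :=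
  {ω | ∃ t : ℝ, |t| ≤ 1 ∧ (ω.1 - t) ^ 2 + (ω.2 - t ^ 2) ^ 2 ≤ ((N : ℝ) ^ (4 : ℕ))⁻¹}

/-- The piece `θ_j = Ω ∩ {|ω₁ - j/N| ≤ 1/(2N)}` of the decomposition. -/
def parabolaPiece (N : ℕ) (j : ℤ) : Set (ℝ × ℝ) :=
  parabolaNbhd N ∩ {ω | |ω.1 - (j : ℝ) / N| ≤ 1 / (2 * N)}

/-- The Fourier restriction `f_θ` of `f` to a set `θ` of frequencies. -/
noncomputable def fourierPieceE (f : SchwartzMap (EuclideanSpace ℝ (Fin 2)) ℂ)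
    (θ : Set (ℝ × ℝ)) (x : EuclideanSpace ℝ (Fin 2)) : ℂ :=
  ∫ ω in θ, fourierTransformE f ω *
    Complex.exp (2 * Real.pi * Complex.I * ((ω.1 * x 0 + ω.2 * x 1 : ℝ) : ℂ))

section

open scoped Pointwise

/-- The Euclidean plane on which the functions live. -/
abbrev Plane := EuclideanSpace ℝ (Fin 2)

/-- The character `x ↦ exp (2πi ω·x)` of the plane. -/
noncomputable def planeChar (ω : ℝ × ℝ) (x : Plane) : ℂ :=
  Complex.exp (2 * Real.pi * Complex.I * ((ω.1 * x 0 + ω.2 * x 1 : ℝ) : ℂ))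

lemma planeChar_add (ω ξ : ℝ × ℝ) (x : Plane) :
    planeChar (ω + ξ) x = planeChar ω x * planeChar ξ x := by
  simp only [planeChar, ← Complex.exp_add, Prod.fst_add, Prod.snd_add]
  congr 1
  push_cast
  ring

lemma conj_planeChar (ω : ℝ × ℝ) (x : Plane) :
    (starRingEnd ℂ) (planeChar ω x) = planeChar (-ω) x := by
  simp only [planeChar, ← Complex.exp_conj, map_mul, Complex.conj_I, Complex.conj_ofReal,
    map_ofNat, Prod.fst_neg, Prod.snd_neg]
  congr 1
  push_cast
  ring

lemma norm_planeChar (ω : ℝ × ℝ) (x : Plane) : ‖planeChar ω x‖ = 1 := by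
  rw [planeChar, show (2 * Real.pi * Complex.I * ((ω.1 * x 0 + ω.2 * x 1 : ℝ) : ℂ)) =
    ((2 * Real.pi * (ω.1 * x 0 + ω.2 * x 1) : ℝ) : ℂ) * Complex.I by push_cast; ring]
  exact Complex.norm_exp_ofReal_mul_I _

lemma continuous_planeChar : Continuous fun p : (ℝ × ℝ) × Plane ↦ planeChar p.1 p.2 := by
  unfold planeChar
  fun_prop

lemma MeasureTheory.Integrable.mul_planeChar {w : Plane → ℂ} (hw : Integrable w) (ω : ℝ × ℝ) :
    Integrable fun x ↦ w x * planeChar ω x :=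
  hw.mul_bdd (continuous_planeChar.comp (Continuous.prodMk_right ω)).aestronglyMeasurable
    (.of_forall fun x ↦ (norm_planeChar ω x).le)

/-- A bounded function has spectrum in `S` if it is orthogonal to every integrable function whose
Fourier transform (with the sign convention `∫ w(x) e(ω·x) dx`) vanishes on `S`. -/
structure HasSpectrumIn (h : Plane → ℂ) (S : Set (ℝ × ℝ)) : Prop where
  aestronglyMeasurable : AEStronglyMeasurable h volume
  bounded : ∃ C, ∀ x, ‖h x‖ ≤ C
  integral_mul_eq_zero : ∀ w : Plane → ℂ, Integrable w →
    (∀ ω ∈ S, ∫ x, w x * planeChar ω x = 0) → ∫ x, w x * h x = 0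

namespace HasSpectrumIn

variable {h g : Plane → ℂ} {S T : Set (ℝ × ℝ)}

lemma integrable_mul (hh : HasSpectrumIn h S) {w : Plane → ℂ} (hw : Integrable w) :
    Integrable fun x ↦ w x * h x := by
  obtain ⟨C, hC⟩ := hh.bounded
  exact hw.mul_bdd hh.aestronglyMeasurable (.of_forall hC)

lemma zero (S : Set (ℝ × ℝ)) : HasSpectrumIn (fun _ ↦ 0) S :=
  ⟨aestronglyMeasurable_const, ⟨0, by simp⟩, by simp⟩

lemma mono (hh : HasSpectrumIn h S) (hST : S ⊆ T) : HasSpectrumIn h T :=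
  ⟨hh.1, hh.2, fun w hw hT ↦ hh.3 w hw fun ω hω ↦ hT ω (hST hω)⟩

lemma conj (hh : HasSpectrumIn h S) : HasSpectrumIn (fun x ↦ (starRingEnd ℂ) (h x)) (-S) := by
  refine ⟨Complex.continuous_conj.comp_aestronglyMeasurable hh.1, ?_, fun w hw hS ↦ ?_⟩
  · obtain ⟨C, hC⟩ := hh.bounded
    exact ⟨C, fun x ↦ by simpa using hC x⟩
  · have := hh.3 (fun x ↦ (starRingEnd ℂ) (w x)) (by
      refine hw.congr' (Complex.continuous_conj.comp_aestronglyMeasurable hw.1) ?_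
      exact .of_forall fun x ↦ by simp) fun ω hω ↦ by
        have h1 := hS (-ω) (by simpa using hω)
        have h2 := congrArg (starRingEnd ℂ) h1
        rw [← integral_conj] at h2
        simpa [conj_planeChar] using h2
    have h2 := congrArg (starRingEnd ℂ) this
    rw [← integral_conj] at h2
    simpa using h2

lemma mul (hh : HasSpectrumIn h S) (hg : HasSpectrumIn g T) :
    HasSpectrumIn (fun x ↦ h x * g x) (S + T) := by
  refine ⟨hh.1.mul hg.1, ?_, fun w hw hST ↦ ?_⟩
  · obtain ⟨C, hC⟩ := hh.bounded
    obtain ⟨D, hD⟩ := hg.bounded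
    exact ⟨C * D, fun x ↦ by
      rw [norm_mul]
      exact mul_le_mul (hC x) (hD x) (norm_nonneg _) ((norm_nonneg _).trans (hC x))⟩
  · have := hh.3 (fun x ↦ w x * g x) (hg.integrable_mul hw) fun ω hω ↦ by
      have := hg.3 (fun x ↦ w x * planeChar ω x) (hw.mul_planeChar ω) fun ξ hξ ↦ by
        simpa [planeChar_add, mul_assoc] using hST (ω + ξ) (Set.add_mem_add hω hξ)
      simpa [mul_right_comm] using this
    simpa [mul_assoc, mul_comm (h _)] using this

lemma mul_conj (hh : HasSpectrumIn h S) (hg : HasSpectrumIn g T) :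
    HasSpectrumIn (fun x ↦ h x * (starRingEnd ℂ) (g x)) (S - T) := by
  simpa [sub_eq_add_neg] using hh.mul hg.conj

lemma sum {ι : Type*} {A : Finset ι} {h : ι → Plane → ℂ}
    (hh : ∀ a ∈ A, HasSpectrumIn (h a) S) : HasSpectrumIn (fun x ↦ ∑ a ∈ A, h a x) S := by
  refine ⟨Finset.aestronglyMeasurable_fun_sum _ fun a ha ↦ (hh a ha).1, ?_, fun w hw hS ↦ ?_⟩
  · choose! C hC using fun a ha ↦ (hh a ha).bounded
    exact ⟨∑ a ∈ A, C a, fun x ↦ norm_sum_le_of_le _ fun a ha ↦ hC a ha x⟩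
  · simp only [Finset.mul_sum]
    rw [integral_finsetSum _ fun a ha ↦ (hh a ha).integrable_mul hw]
    exact Finset.sum_eq_zero fun a ha ↦ (hh a ha).3 w hw hS

/-- Multiplying a weight by a function with spectrum in `S` moves the support of the Fourier
transform of the weight by `S`. -/
lemma integral_mul_planeChar_eq_zero (hh : HasSpectrumIn h S) {w : Plane → ℂ} (hw : Integrable w)
    {ω : ℝ × ℝ} (hω : ∀ s ∈ S, ∫ x, w x * planeChar (ω + s) x = 0) :
    ∫ x, w x * h x * planeChar ω x = 0 := by
  have := hh.3 (fun x ↦ w x * planeChar ω x) (hw.mul_planeChar ω) fun s hs ↦ by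
    simpa [planeChar_add, mul_assoc] using hω s hs
  simpa [mul_right_comm] using this

end HasSpectrumIn

/-- Almost orthogonality in a weighted `L²` space. -/
lemma integral_normSq_sum_mul_le {ι : Type*} [DecidableEq ι] {A : Finset ι} {h : ι → Plane → ℂ}
    {S : ι → Set (ℝ × ℝ)} {w : Plane → ℝ} {W : Set (ℝ × ℝ)} (hw : Integrable w)
    (hw0 : ∀ x, 0 ≤ w x) (hW : ∀ ω ∉ W, ∫ x, (w x : ℂ) * planeChar ω x = 0)
    (hh : ∀ a ∈ A, HasSpectrumIn (h a) (S a)) (hb : ∀ a ∈ A, ∀ x, ‖h a x‖ ≤ 1)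
    {R : Finset (ι × ι)}
    (hR : ∀ a ∈ A, ∀ b ∈ A, (∃ s ∈ S a - S b, s ∈ W) → (a, b) ∈ R) :
    ∫ x, w x * ‖∑ a ∈ A, h a x‖ ^ 2 ≤ R.card * ∫ x, w x := by
  have hwc : Integrable fun x ↦ (w x : ℂ) := hw.ofReal
  have hint : ∀ p ∈ A ×ˢ A, Integrable fun x ↦
      (w x : ℂ) * (h p.1 x * (starRingEnd ℂ) (h p.2 x)) := fun p hp ↦ by
    rw [Finset.mem_product] at hp
    exact ((hh _ hp.1).mul_conj (hh _ hp.2)).integrable_mul hwc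
  have key : ((∫ x, w x * ‖∑ a ∈ A, h a x‖ ^ 2 : ℝ) : ℂ) =
      ∑ p ∈ A ×ˢ A, ∫ x, (w x : ℂ) * (h p.1 x * (starRingEnd ℂ) (h p.2 x)) := by
    rw [← integral_finsetSum _ hint, ← integral_complex_ofReal]
    congr 1
    ext x
    simp only [← Finset.mul_sum, Finset.sum_product]
    rw [← Finset.sum_mul, ← map_sum, Complex.mul_conj']
    push_cast
    rfl
  have h0 : 0 ≤ ∫ x, w x * ‖∑ a ∈ A, h a x‖ ^ 2 :=
    integral_nonneg fun x ↦ mul_nonneg (hw0 x) (sq_nonneg _)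
  have hbound : ∀ p ∈ A ×ˢ A, ‖∫ x, (w x : ℂ) * (h p.1 x * (starRingEnd ℂ) (h p.2 x))‖ ≤
      if p ∈ R then ∫ x, w x else 0 := fun p hp ↦ by
    have hp' := Finset.mem_product.1 hp
    split_ifs with hpR
    · refine norm_integral_le_of_norm_le hw (.of_forall fun x ↦ ?_)
      rw [norm_mul, norm_mul, RCLike.norm_conj, Complex.norm_of_nonneg (hw0 x)]
      exact mul_le_of_le_one_right (hw0 x)
        (mul_le_one₀ (hb _ hp'.1 x) (norm_nonneg _) (hb _ hp'.2 x))
    · rw [((hh _ hp'.1).mul_conj (hh _ hp'.2)).3 _ hwc fun s hs ↦ hW s fun hsW ↦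
        hpR (hR _ hp'.1 _ hp'.2 ⟨s, hs, hsW⟩), norm_zero]
  calc ∫ x, w x * ‖∑ a ∈ A, h a x‖ ^ 2
      = ‖((∫ x, w x * ‖∑ a ∈ A, h a x‖ ^ 2 : ℝ) : ℂ)‖ := (Complex.norm_of_nonneg h0).symm
    _ ≤ ∑ p ∈ A ×ˢ A, if p ∈ R then ∫ x, w x else 0 := by
        rw [key]
        exact norm_sum_le_of_le _ hbound
    _ = ((A ×ˢ A).filter (· ∈ R)).card * ∫ x, w x := by
        rw [← Finset.sum_filter, Finset.sum_const, nsmul_eq_mul]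
    _ ≤ R.card * ∫ x, w x := by
        gcongr
        · exact integral_nonneg hw0
        · exact fun p hp ↦ (Finset.mem_filter.1 hp).2

/-- The identification of the plane with `ℝ × ℝ`. -/
noncomputable def planeEquivProd : Plane ≃ᵐ ℝ × ℝ :=
  (MeasurableEquiv.toLp 2 (Fin 2 → ℝ)).symm.trans MeasurableEquiv.finTwoArrow

lemma measurePreserving_planeEquivProd :
    MeasurePreserving planeEquivProd (volume : Measure Plane) volume :=
  (volume_preserving_finTwoArrow ℝ).comp
    (EuclideanSpace.volume_preserving_symm_measurableEquiv_toLp (Fin 2))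

lemma planeEquivProd_apply (v : Plane) : planeEquivProd v = (v 0, v 1) := rfl

lemma fourierTransformE_eq (f : SchwartzMap Plane ℂ) (v : Plane) :
    fourierTransformE f (planeEquivProd v) = FourierTransform.fourier f v := by
  rw [SchwartzMap.fourier_coe, Real.fourier_eq', fourierTransformE]
  congr 1
  ext x
  rw [smul_eq_mul, mul_comm]
  congr 2
  simp only [planeEquivProd_apply, PiLp.inner_apply, Fin.sum_univ_two, RCLike.inner_apply,
    conj_trivial]
  push_cast
  ring

lemma integrable_fourierTransformE (f : SchwartzMap Plane ℂ) :
    Integrable (fourierTransformE f) := by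
  rw [← measurePreserving_planeEquivProd.integrable_comp_emb planeEquivProd.measurableEmbedding]
  exact (FourierTransform.fourier f).integrable.congr
    (.of_forall fun v ↦ (fourierTransformE_eq f v).symm)

lemma integral_fourierTransformE_mul_planeChar (f : SchwartzMap Plane ℂ) (x : Plane) :
    ∫ ω, fourierTransformE f ω * planeChar ω x = f x := by
  rw [← measurePreserving_planeEquivProd.integral_comp planeEquivProd.measurableEmbedding]
  have : f x = FourierTransformInv.fourierInv (FourierTransform.fourier f) x := by
    rw [FourierTransform.fourierInv_fourier_eq]
  rw [this, SchwartzMap.fourierInv_coe, Real.fourierInv_eq']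
  congr 1
  ext v
  rw [fourierTransformE_eq, smul_eq_mul, mul_comm, planeChar]
  congr 2
  simp only [planeEquivProd_apply, PiLp.inner_apply, Fin.sum_univ_two, RCLike.inner_apply,
    conj_trivial]
  push_cast
  ring

/-- The transform of an integrable function that vanishes off `S` has spectrum in `S`. -/
lemma hasSpectrumIn_integral {F : ℝ × ℝ → ℂ} (hF : Integrable F) {S : Set (ℝ × ℝ)}
    (hS : ∀ ω ∉ S, F ω = 0) : HasSpectrumIn (fun x ↦ ∫ ω, F ω * planeChar ω x) S := by
  have hchar : Continuous fun p : Plane × (ℝ × ℝ) ↦ planeChar p.2 p.1 :=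
    continuous_planeChar.comp continuous_swap
  refine ⟨?_, ⟨∫ ω, ‖F ω‖, fun x ↦ ?_⟩, fun w hw h0 ↦ ?_⟩
  · refine (continuous_of_dominated (bound := fun ω ↦ ‖F ω‖) (fun x ↦ ?_) (fun x ↦ ?_) hF.norm
      ?_).aestronglyMeasurable
    · exact hF.1.mul (hchar.comp (Continuous.prodMk_right x)).aestronglyMeasurable
    · exact .of_forall fun ω ↦ by rw [norm_mul, norm_planeChar, mul_one]
    · exact .of_forall fun ω ↦
        continuous_const.mul (hchar.comp (Continuous.prodMk_left ω))
  · refine (norm_integral_le_integral_norm _).trans_eq ?_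
    simp [norm_planeChar]
  · have hint : Integrable (Function.uncurry fun (x : Plane) (ω : ℝ × ℝ) ↦
        w x * (F ω * planeChar ω x)) (volume.prod volume) := by
      refine ((hw.mul_prod hF).mul_bdd (c := 1) hchar.aestronglyMeasurable
        (.of_forall fun p ↦ (norm_planeChar _ _).le)).congr (.of_forall fun p ↦ ?_)
      simp [Function.uncurry, mul_assoc]
    simp_rw [← integral_const_mul]
    rw [integral_integral_swap hint]
    refine (integral_congr_ae (.of_forall fun ω ↦ ?_)).trans (integral_zero _ _)
    by_cases hω : ω ∈ S
    · simp_rw [mul_left_comm _ (F ω)]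
      rw [integral_const_mul, h0 ω hω, mul_zero]
    · simp [hS ω hω]

/-- The vertical strip containing the piece `θ_j`. -/
def freqStrip (N : ℕ) (j : ℤ) : Set (ℝ × ℝ) := {ω | |ω.1 - (j : ℝ) / N| ≤ 1 / (2 * N)}

lemma freqStrip_eq_prod (N : ℕ) (j : ℤ) : freqStrip N j =
    Set.Icc ((j : ℝ) / N - 1 / (2 * N)) ((j : ℝ) / N + 1 / (2 * N)) ×ˢ Set.univ := by
  ext ω
  simp only [freqStrip, Set.mem_ofPred_eq, Set.mem_prod, Set.mem_Icc, Set.mem_univ, and_true,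
    abs_le]
  constructor <;> rintro ⟨h1, h2⟩ <;> constructor <;> linarith

lemma measurableSet_freqStrip (N : ℕ) (j : ℤ) : MeasurableSet (freqStrip N j) := by
  rw [freqStrip_eq_prod]
  exact measurableSet_Icc.prod .univ

section pieces

variable {N : ℕ} {f : SchwartzMap Plane ℂ}

lemma fourierPieceE_eq_setIntegral
    (hf : ∀ ω ∉ parabolaNbhd N, fourierTransformE f ω = 0) (j : ℤ) (x : Plane) :
    fourierPieceE f (parabolaPiece N j) x =
      ∫ ω in freqStrip N j, fourierTransformE f ω * planeChar ω x := by
  refine (setIntegral_eq_of_subset_of_forall_sdiff_eq_zero (measurableSet_freqStrip N j)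
    Set.inter_subset_right fun ω hω ↦ ?_).symm
  rw [hf ω fun h ↦ hω.2 ⟨h, hω.1⟩, zero_mul]

lemma hasSpectrumIn_fourierPieceE
    (hf : ∀ ω ∉ parabolaNbhd N, fourierTransformE f ω = 0) (j : ℤ) :
    HasSpectrumIn (fourierPieceE f (parabolaPiece N j)) (parabolaPiece N j) := by
  have := hasSpectrumIn_integral (S := parabolaPiece N j)
    ((integrable_fourierTransformE f).indicator (measurableSet_freqStrip N j)) fun ω hω ↦ by
      by_cases hs : ω ∈ freqStrip N j
      · rw [Set.indicator_of_mem hs, hf ω fun h ↦ hω ⟨h, hs⟩]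
      · rw [Set.indicator_of_notMem hs]
  convert this using 2 with x
  rw [fourierPieceE_eq_setIntegral hf, ← integral_indicator (measurableSet_freqStrip N j)]
  simp only [Set.indicator_mul_left]

lemma sum_fourierPieceE (hN : 3 ≤ N)
    (hf : ∀ ω ∉ parabolaNbhd N, fourierTransformE f ω = 0) (x : Plane) :
    ∑ j ∈ Finset.Icc (-(N : ℤ)) N, fourierPieceE f (parabolaPiece N j) x = f x := by
  have hN0 : (0 : ℝ) < N := by positivity
  set I : ℤ → Set (ℝ × ℝ) := fun j ↦
    Set.Ico ((j : ℝ) / N - 1 / (2 * N)) ((j : ℝ) / N + 1 / (2 * N)) ×ˢ Set.univ with hI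
  have hmemI (j : ℤ) (ω : ℝ × ℝ) : ω ∈ I j ↔ ⌊N * ω.1 + 1 / 2⌋ = j := by
    rw [Int.floor_eq_iff]
    simp only [hI, Set.mem_prod, Set.mem_Ico, Set.mem_univ, and_true]
    rw [show (j : ℝ) / N - 1 / (2 * N) = (j - 1 / 2) / N by field_simp,
      show (j : ℝ) / N + 1 / (2 * N) = (j + 1 / 2) / N by field_simp, div_le_iff₀ hN0,
      lt_div_iff₀ hN0]
    constructor <;> rintro ⟨h1, h2⟩ <;> constructor <;> linarith
  have hint : Integrable fun ω ↦ fourierTransformE f ω * planeChar ω x :=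
    (integrable_fourierTransformE f).mul_bdd (c := 1)
      (continuous_planeChar.comp (Continuous.prodMk_left x)).aestronglyMeasurable
      (.of_forall fun ω ↦ (norm_planeChar ω x).le)
  have hae (j : ℤ) : freqStrip N j =ᵐ[volume] I j := by
    rw [freqStrip_eq_prod]
    exact (Measure.set_prod_ae_eq Ico_ae_eq_Icc (ae_eq_refl _)).symm
  simp_rw [fourierPieceE_eq_setIntegral hf, setIntegral_congr_set (hae _)]
  rw [← integral_biUnion_finset _ (fun j _ ↦ measurableSet_Ico.prod .univ)
    (fun i _ j _ hij ↦ Set.disjoint_left.2 fun ω hi hj ↦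
      hij (((hmemI i ω).1 hi).symm.trans ((hmemI j ω).1 hj)))
    (fun j _ ↦ hint.integrableOn), ← integral_fourierTransformE_mul_planeChar]
  refine setIntegral_eq_integral_of_forall_compl_eq_zero fun ω hω ↦ ?_
  rw [hf ω, zero_mul]
  rintro ⟨t, ht, hωt⟩
  refine hω (Set.mem_biUnion (x := ⌊N * ω.1 + 1 / 2⌋) ?_ ((hmemI _ ω).2 rfl))
  have hN3 : (3 : ℝ) ≤ N := by exact_mod_cast hN
  have h1 : |N * (ω.1 - t)| ≤ 1 / 3 := by
    refine abs_le_of_sq_le_sq ?_ (by norm_num)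
    have h2 : (ω.1 - t) ^ 2 ≤ ((N : ℝ) ^ 4)⁻¹ := by nlinarith [sq_nonneg (ω.2 - t ^ 2)]
    calc (N * (ω.1 - t)) ^ 2 = (N : ℝ) ^ 2 * (ω.1 - t) ^ 2 := by ring
      _ ≤ (N : ℝ) ^ 2 * ((N : ℝ) ^ 4)⁻¹ := by gcongr
      _ = ((N : ℝ) ^ 2)⁻¹ := by field_simp
      _ ≤ ((3 : ℝ) ^ 2)⁻¹ := by gcongr
      _ = (1 / 3) ^ 2 := by norm_num
  rw [abs_le] at h1 ht
  have h3 : N * t ≤ N := by nlinarith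
  have h4 : -N ≤ N * t := by nlinarith
  rw [Finset.mem_coe, Finset.mem_Icc]
  constructor
  · rw [Int.le_floor]
    push_cast
    linarith
  · rw [← Int.lt_add_one_iff, Int.floor_lt]
    push_cast
    linarith

end pieces

/-- A nonnegative integrable weight that is at least `1` on the unit ball and whose Fourier
transform vanishes off the unit square. -/
lemma exists_bandlimited_weight : ∃ κ : Plane → ℝ, Integrable κ ∧ (∀ x, 0 ≤ κ x) ∧
    (∀ x, ‖x‖ ≤ 1 → 1 ≤ κ x) ∧
    ∀ ω : ℝ × ℝ, 1 < |ω.1| ∨ 1 < |ω.2| → ∫ x, (κ x : ℂ) * planeChar ω x = 0 := by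
  let b : ContDiffBump (0 : Plane) := ⟨1 / 20, 1 / 10, by norm_num, by norm_num⟩
  have hbc : HasCompactSupport fun v : Plane ↦ (b v : ℂ) :=
    b.hasCompactSupport.comp_left (g := ((↑) : ℝ → ℂ)) Complex.ofReal_zero
  have hbd : ContDiff ℝ (⊤ : ℕ∞) fun v : Plane ↦ (b v : ℂ) :=
    Complex.ofRealCLM.contDiff.comp b.contDiff
  let η : SchwartzMap Plane ℂ := hbc.toSchwartzMap hbd
  have hη (v : Plane) : η v = (b v : ℂ) := rfl
  let ψ : SchwartzMap Plane ℂ := FourierTransform.fourier η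
  have hψ (x : Plane) : ψ x = ∫ v, Complex.exp (↑(-2 * Real.pi * inner ℝ v x) * Complex.I) •
      η v := by
    rw [← Real.fourier_eq', ← SchwartzMap.fourier_coe]
  set c : ℝ := (∫ v, b v) / 2 with hc
  have hc0 : 0 < c := half_pos b.integral_pos
  have hlow (x : Plane) (hx : ‖x‖ ≤ 1) : c ≤ ‖ψ x‖ := by
    refine le_trans ?_ (Complex.re_le_norm _)
    have hint : Integrable fun v ↦ Complex.exp (↑(-2 * Real.pi * inner ℝ v x) * Complex.I) •
        η v := by
      refine η.integrable.bdd_mul (c := 1) (by fun_prop) (.of_forall fun v ↦ ?_)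
      rw [Complex.norm_exp_ofReal_mul_I]
    rw [hψ, ← RCLike.re_eq_complex_re, ← integral_re hint, hc, ← integral_div]
    refine integral_mono (b.integrable.div_const 2) hint.re fun v ↦ ?_
    simp only [RCLike.re_eq_complex_re, hη, smul_eq_mul, Complex.re_mul_ofReal,
      Complex.exp_ofReal_mul_I_re]
    by_cases hv : v ∈ Metric.ball (0 : Plane) (1 / 10)
    · have h1 : |inner ℝ v x| ≤ 1 / 10 := by
        rw [mem_ball_zero_iff] at hv
        refine (abs_real_inner_le_norm v x).trans ?_
        nlinarith [norm_nonneg v, norm_nonneg x]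
      have h2 : 1 / 2 ≤ Real.cos (-2 * Real.pi * inner ℝ v x) := by
        rw [← Real.cos_pi_div_three, ← Real.cos_abs (-2 * Real.pi * _)]
        have hpi := Real.pi_pos
        refine Real.cos_le_cos_of_nonneg_of_le_pi (abs_nonneg _) (by linarith) ?_
        rw [abs_mul, abs_mul, abs_of_pos hpi]
        norm_num
        nlinarith
      nlinarith [b.nonneg' v]
    · have : b v = 0 := by
        rw [← Function.notMem_support, b.support_eq]
        exact hv
      simp [this]
  have hψint : Integrable fun x ↦ ‖ψ x‖ ^ 2 :=
    (memLp_two_iff_integrable_sq_norm ψ.continuous.aestronglyMeasurable).1 (ψ.memLp 2)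
  refine ⟨fun x ↦ ‖ψ x‖ ^ 2 / c ^ 2, hψint.div_const _, fun x ↦ by positivity, fun x hx ↦ ?_,
    fun ω hω ↦ ?_⟩
  · rw [one_le_div (by positivity)]
    gcongr
    exact hlow x hx
  · let a : Plane := !₂[ω.1, ω.2]
    let ξ : SchwartzMap Plane ℂ := SchwartzMap.compSubConstCLM ℂ a η
    have hξ (x : Plane) : FourierTransform.fourier ξ x = planeChar (-ω) x * ψ x := by
      rw [SchwartzMap.fourier_coe, Real.fourier_eq', hψ, ← integral_add_right_eq_self _ a,
        ← integral_const_mul]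
      congr 1
      ext v
      rw [SchwartzMap.compSubConstCLM_apply, add_sub_cancel_right, smul_eq_mul, smul_eq_mul,
        ← mul_assoc, planeChar, ← Complex.exp_add]
      congr 2
      simp only [a, inner_add_left, PiLp.inner_apply, Fin.sum_univ_two, RCLike.inner_apply,
        conj_trivial, Prod.fst_neg, Prod.snd_neg, Matrix.cons_val_zero,
        Matrix.cons_val_one]
      push_cast
      ring
    have h := SchwartzMap.integral_inner_fourier_fourier ξ η
    have hzero : ∫ x, inner ℂ (ξ x) (η x) = 0 := by
      refine (integral_congr_ae (.of_forall fun x ↦ ?_)).trans (integral_zero _ _)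
      have ha : 1 < ‖a‖ := by
        rcases hω with h | h
        · exact h.trans_le (PiLp.norm_apply_le a 0)
        · exact h.trans_le (PiLp.norm_apply_le a 1)
      by_cases hx : x ∈ Metric.ball (0 : Plane) (1 / 10)
      · have : b (x - a) = 0 := by
          rw [← Function.notMem_support, b.support_eq, mem_ball_zero_iff, not_lt]
          rw [mem_ball_zero_iff] at hx
          change (1 / 10 : ℝ) ≤ _
          linarith [norm_sub_norm_le a x, norm_sub_rev a x]
        simp [ξ, SchwartzMap.compSubConstCLM_apply, hη, this]
      · have : b x = 0 := by
          rw [← Function.notMem_support, b.support_eq]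
          exact hx
        simp [hη, this]
    rw [hzero] at h
    have hpt (x : Plane) : ((‖ψ x‖ ^ 2 / c ^ 2 : ℝ) : ℂ) * planeChar ω x =
        inner ℂ (FourierTransform.fourier ξ x) (ψ x) * ((c ^ 2 : ℝ) : ℂ)⁻¹ := by
      rw [hξ, RCLike.inner_apply, map_mul, conj_planeChar, neg_neg]
      push_cast
      rw [← Complex.mul_conj']
      ring
    simp_rw [hpt]
    rw [integral_mul_const, h, zero_mul]

/-- The rescaled description of the piece `θ_j`, with frequencies measured in units of
`1 / N` horizontally and `1 / N ^ 2` vertically. -/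
lemma mem_parabolaPiece_bounds {N : ℕ} (hN : 1 ≤ N) {j : ℤ} {ω : ℝ × ℝ}
    (hω : ω ∈ parabolaPiece N j) :
    |N * ω.1 - j| ≤ 1 / 2 ∧ |N ^ 2 * ω.2 - (N * ω.1) ^ 2| ≤ 4 ∧ |N * ω.1| ≤ N + 1 := by
  obtain ⟨⟨t, ht, hωt⟩, hj⟩ := hω
  have hN1 : (1 : ℝ) ≤ N := by exact_mod_cast hN
  have hN0 : (0 : ℝ) < N := by positivity
  have h4 : ((N : ℝ) ^ 4)⁻¹ = (((N : ℝ) ^ 2)⁻¹) ^ 2 := by rw [inv_pow, ← pow_mul]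
  have hd0 : 0 < ((N : ℝ) ^ 2)⁻¹ := by positivity
  have hd1 : ((N : ℝ) ^ 2)⁻¹ ≤ 1 := inv_le_one_of_one_le₀ (one_le_pow₀ hN1)
  have hNd : (N : ℝ) ^ 2 * ((N : ℝ) ^ 2)⁻¹ = 1 := mul_inv_cancel₀ (by positivity)
  set d := ((N : ℝ) ^ 2)⁻¹
  have h1 : |ω.1 - t| ≤ d := abs_le_of_sq_le_sq (by nlinarith [sq_nonneg (ω.2 - t ^ 2)]) hd0.le
  have h2 : |ω.2 - t ^ 2| ≤ d := abs_le_of_sq_le_sq (by nlinarith [sq_nonneg (ω.1 - t)]) hd0.le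
  refine ⟨?_, ?_, ?_⟩
  · have : N * ω.1 - j = N * (ω.1 - j / N) := by field_simp
    rw [this, abs_mul, abs_of_pos hN0]
    calc (N : ℝ) * |ω.1 - j / N| ≤ N * (1 / (2 * N)) := by gcongr; exact hj
      _ = 1 / 2 := by field_simp
  · have h3 : |t + ω.1| ≤ 3 := by
      rw [abs_le] at *
      constructor <;> linarith
    have h5 : |ω.2 - ω.1 ^ 2| ≤ 4 * d := by
      have : ω.2 - ω.1 ^ 2 = (ω.2 - t ^ 2) - (ω.1 - t) * (t + ω.1) := by ring
      rw [this]
      refine (abs_sub _ _).trans ?_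
      rw [abs_mul]
      nlinarith [abs_nonneg (ω.1 - t), abs_nonneg (t + ω.1)]
    have : N ^ 2 * ω.2 - (N * ω.1) ^ 2 = N ^ 2 * (ω.2 - ω.1 ^ 2) := by ring
    rw [this, abs_mul, abs_of_pos (by positivity)]
    nlinarith
  · have h3 : |ω.1| ≤ 1 + d := by
      rw [abs_le] at *
      constructor <;> linarith
    rw [abs_mul, abs_of_pos hN0]
    have : N * d ≤ 1 := by nlinarith
    nlinarith

/-- Differences of nearby pieces are short. -/
lemma sub_parabolaPiece_bounds {N : ℕ} (hN : 1 ≤ N) {k l : ℤ} {K : ℝ} (hkl : |(k : ℝ) - l| + 1 ≤ K)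
    {s : ℝ × ℝ} (hs : s ∈ parabolaPiece N k - parabolaPiece N l) :
    |N * s.1| ≤ K ∧ |N ^ 2 * s.2| ≤ (4 * K + 8) * N := by
  obtain ⟨ω, hω, ξ, hξ, rfl⟩ := hs
  obtain ⟨a1, a2, a3⟩ := mem_parabolaPiece_bounds hN hω
  obtain ⟨b1, b2, b3⟩ := mem_parabolaPiece_bounds hN hξ
  have hN1 : (1 : ℝ) ≤ N := by exact_mod_cast hN
  simp only [Prod.fst_sub, Prod.snd_sub, mul_sub]
  generalize (N : ℝ) * ω.1 = u at *
  generalize (N : ℝ) * ξ.1 = u' at *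
  generalize (N : ℝ) ^ 2 * ω.2 = v at *
  generalize (N : ℝ) ^ 2 * ξ.2 = v' at *
  have hd : |u - u'| ≤ K := by
    have : u - u' = (u - k) - (u' - l) + (k - l) := by ring
    rw [this]
    linarith [abs_add_le ((u - k) - (u' - l)) (k - l), abs_sub (u - k) (u' - l)]
  refine ⟨hd, ?_⟩
  have h : v - v' = (v - u ^ 2) - (v' - u' ^ 2) + (u - u') * (u + u') := by ring
  rw [h]
  have h1 := abs_add_le ((v - u ^ 2) - (v' - u' ^ 2)) ((u - u') * (u + u'))
  have h2 := abs_sub (v - u ^ 2) (v' - u' ^ 2)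
  have h3 : |(u - u') * (u + u')| ≤ K * (4 * N) := by
    rw [abs_mul]
    refine mul_le_mul hd ?_ (abs_nonneg _) ((abs_nonneg _).trans hd)
    linarith [abs_add_le u u']
  nlinarith

/-- The common part of both separation arguments: if two differences of pieces nearly coincide,
then so do the sums, up to the inverse of the separation. -/
lemma sub_sub_parabolaPiece_bounds {N : ℕ} (hN : 1 ≤ N) {k l k' l' : ℤ} {ρ σ : ℝ}
    (hkl : 1 ≤ |(k : ℝ) - l|) {z : ℝ × ℝ}
    (hz : z ∈ (parabolaPiece N k - parabolaPiece N l) -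
      (parabolaPiece N k' - parabolaPiece N l'))
    (hz1 : |N * z.1| ≤ ρ) (hz2 : |N ^ 2 * z.2| ≤ σ) :
    |((k : ℝ) - l) - (k' - l')| ≤ ρ + 2 ∧
      (|(k : ℝ) - l| - 1) * (|((k : ℝ) + l) - (k' + l')| - 2) ≤ σ + 16 + ρ * (4 * N) := by
  obtain ⟨-, ⟨ω₁, h₁, ω₂, h₂, rfl⟩, -, ⟨ω₃, h₃, ω₄, h₄, rfl⟩, rfl⟩ := hz
  obtain ⟨a₁, b₁, c₁⟩ := mem_parabolaPiece_bounds hN h₁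
  obtain ⟨a₂, b₂, c₂⟩ := mem_parabolaPiece_bounds hN h₂
  obtain ⟨a₃, b₃, c₃⟩ := mem_parabolaPiece_bounds hN h₃
  obtain ⟨a₄, b₄, c₄⟩ := mem_parabolaPiece_bounds hN h₄
  have hN1 : (1 : ℝ) ≤ N := by exact_mod_cast hN
  simp only [Prod.fst_sub, Prod.snd_sub, mul_sub] at hz1 hz2
  generalize (N : ℝ) * ω₁.1 = u₁ at *
  generalize (N : ℝ) * ω₂.1 = u₂ at *
  generalize (N : ℝ) * ω₃.1 = u₃ at *
  generalize (N : ℝ) * ω₄.1 = u₄ at *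
  generalize (N : ℝ) ^ 2 * ω₁.2 = v₁ at *
  generalize (N : ℝ) ^ 2 * ω₂.2 = v₂ at *
  generalize (N : ℝ) ^ 2 * ω₃.2 = v₃ at *
  generalize (N : ℝ) ^ 2 * ω₄.2 = v₄ at *
  have hρ : 0 ≤ ρ := (abs_nonneg _).trans hz1
  have hs : |u₃ + u₄| ≤ 4 * N := by linarith [abs_add_le u₃ u₄]
  have hd : |(k : ℝ) - l| - 1 ≤ |u₁ - u₂| := by
    have h : (k : ℝ) - l = (u₁ - u₂) - ((u₁ - k) - (u₂ - l)) := by ring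
    have h' := abs_sub (u₁ - u₂) ((u₁ - k) - (u₂ - l))
    rw [← h] at h'
    linarith [abs_sub (u₁ - k) (u₂ - l)]
  have hS : |((k : ℝ) + l) - (k' + l')| - 2 ≤ |(u₁ + u₂) - (u₃ + u₄)| := by
    rw [abs_le] at a₁ a₂ a₃ a₄
    rcases abs_cases (((k : ℝ) + l) - (k' + l')) with h | h <;>
      rcases abs_cases ((u₁ + u₂) - (u₃ + u₄)) with h' | h' <;> linarith
  have hprod : |u₁ - u₂| * |(u₁ + u₂) - (u₃ + u₄)| ≤ σ + 16 + ρ * (4 * N) := by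
    have h : (u₁ - u₂) * ((u₁ + u₂) - (u₃ + u₄)) =
        (v₁ - v₂ - (v₃ - v₄)) - ((v₁ - u₁ ^ 2) - (v₂ - u₂ ^ 2) - ((v₃ - u₃ ^ 2) - (v₄ - u₄ ^ 2))) -
          (u₁ - u₂ - (u₃ - u₄)) * (u₃ + u₄) := by ring
    have h' : |(u₁ - u₂ - (u₃ - u₄)) * (u₃ + u₄)| ≤ ρ * (4 * N) := by
      rw [abs_mul]
      exact mul_le_mul hz1 hs (abs_nonneg _) hρ
    rw [← abs_mul, h]
    rw [abs_le] at *
    constructor <;> linarith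
  refine ⟨?_, ?_⟩
  · rw [abs_le] at *
    constructor <;> linarith
  · calc (|(k : ℝ) - l| - 1) * (|((k : ℝ) + l) - (k' + l')| - 2)
        ≤ (|(k : ℝ) - l| - 1) * |(u₁ + u₂) - (u₃ + u₄)| := by
          gcongr
      _ ≤ |u₁ - u₂| * |(u₁ + u₂) - (u₃ + u₄)| := by gcongr
      _ ≤ _ := hprod

section combinatorics

variable {N : ℕ} {a : ℤ → ℂ}

/-- The pairs of indices that are far apart. -/
noncomputable def farPairs (N : ℕ) : Finset (ℤ × ℤ) :=
  (Finset.Icc (-(N : ℤ)) N ×ˢ Finset.Icc (-(N : ℤ)) N).filter fun p ↦ (N : ℤ) ≤ 2400 * |p.1 - p.2|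

/-- The residues modulo `5400`. -/
@[irreducible] noncomputable def blockResidues : Finset ℤ := Finset.Ico 0 5400

lemma mem_blockResidues {r : ℤ} : r ∈ blockResidues ↔ 0 ≤ r ∧ r < 5400 := by
  rw [blockResidues, Finset.mem_Ico]

lemma card_blockResidues : blockResidues.card = 5400 := by
  rw [blockResidues, Int.card_Ico]
  rfl

/-- The pairs of distinct nonadjacent residues modulo `5400`. -/
noncomputable def residuePairs : Finset (ℤ × ℤ) :=
  (blockResidues ×ˢ blockResidues).filter fun p ↦ 2 ≤ |p.1 - p.2|

lemma card_residuePairs_le : (residuePairs.card : ℝ) ≤ 5400 ^ 2 := by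
  have h : residuePairs.card ≤ (blockResidues ×ˢ blockResidues).card := Finset.card_filter_le _ _
  rw [Finset.card_product, card_blockResidues] at h
  have h' : (residuePairs.card : ℝ) ≤ ((5400 * 5400 : ℕ) : ℝ) := Nat.cast_le.2 h
  exact h'.trans_eq (by norm_num)

/-- The block indices needed to cover `[-N, N]` by blocks of length `5400`. -/
noncomputable def blockIndices (N : ℕ) : Finset ℤ :=
  Finset.Icc (-((N : ℤ) / 5400) - 1) ((N : ℤ) / 5400 + 1)

lemma card_blockIndices_le (hN : 20000 ≤ N) : ((blockIndices N).card : ℝ) ≤ N / 1800 := by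
  have : ((blockIndices N).card : ℤ) ≤ (N : ℤ) / 1800 := by
    rw [blockIndices, Int.card_Icc]
    omega
  have h2 : (((N : ℤ) / 1800 : ℤ) : ℝ) ≤ (N : ℝ) / 1800 := by
    have := Int.mul_ediv_self_le (x := (N : ℤ)) (k := 1800) (by norm_num)
    have : (1800 : ℝ) * (((N : ℤ) / 1800 : ℤ) : ℝ) ≤ N := by exact_mod_cast this
    linarith
  refine le_trans ?_ h2
  exact_mod_cast this

lemma card_Icc_filter_near (k : ℤ) (R : ℕ) (A : Finset ℤ) :
    (A.filter fun l ↦ |k - l| ≤ R).card ≤ 2 * R + 1 := by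
  have : A.filter (fun l ↦ |k - l| ≤ R) ⊆ Finset.Icc (k - R) (k + R) := fun l hl ↦ by
    have := (Finset.mem_filter.1 hl).2
    rw [abs_le] at this
    rw [Finset.mem_Icc]
    omega
  refine (Finset.card_le_card this).trans ?_
  rw [Int.card_Icc]
  omega

lemma card_filter_product_near (A : Finset ℤ) (R : ℕ) :
    ((A ×ˢ A).filter fun p ↦ |p.1 - p.2| ≤ (R : ℤ)).card ≤ A.card * (2 * R + 1) := by
  rw [Finset.card_filter, Finset.sum_product]
  refine (Finset.sum_le_card_nsmul _ _ (2 * R + 1) fun k _ ↦ ?_).trans_eq (by simp)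
  rw [← Finset.card_filter]
  exact card_Icc_filter_near k R A

lemma norm_mul_conj_le_one (ha : ∀ j, ‖a j‖ ≤ 1) (k l : ℤ) :
    ‖a k * (starRingEnd ℂ) (a l)‖ ≤ 1 := by
  rw [norm_mul, RCLike.norm_conj]
  exact mul_le_one₀ (ha k) (norm_nonneg _) (ha l)

lemma le_norm_sum_farPairs (hN : 20000 ≤ N) (ha : ∀ j, ‖a j‖ ≤ 1)
    (hsum : (N : ℝ) / 10 ≤ ‖∑ j ∈ Finset.Icc (-(N : ℤ)) N, a j‖) :
    (N : ℝ) ^ 2 / 200 ≤ ‖∑ p ∈ farPairs N, a p.1 * (starRingEnd ℂ) (a p.2)‖ := by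
  set A := Finset.Icc (-(N : ℤ)) N with hA
  have hN' : (20000 : ℝ) ≤ N := by exact_mod_cast hN
  have hsq : ((‖∑ j ∈ A, a j‖ ^ 2 : ℝ) : ℂ) =
      ∑ p ∈ A ×ˢ A, a p.1 * (starRingEnd ℂ) (a p.2) := by
    rw [Finset.sum_product]
    simp only [← Finset.mul_sum]
    rw [← Finset.sum_mul, ← map_sum, Complex.mul_conj']
    push_cast
    rfl
  have hsplit := Finset.sum_filter_add_sum_filter_not (A ×ˢ A)
    (fun p ↦ (N : ℤ) ≤ 2400 * |p.1 - p.2|) fun p ↦ a p.1 * (starRingEnd ℂ) (a p.2)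
  have hnear : ‖∑ p ∈ (A ×ˢ A).filter (fun p ↦ ¬ (N : ℤ) ≤ 2400 * |p.1 - p.2|),
      a p.1 * (starRingEnd ℂ) (a p.2)‖ ≤ (N : ℝ) ^ 2 / 200 := by
    refine (norm_sum_le_of_le _ fun p _ ↦ norm_mul_conj_le_one ha p.1 p.2).trans ?_
    rw [Finset.sum_const, nsmul_eq_mul, mul_one]
    have h1 : (A ×ˢ A).filter (fun p ↦ ¬ (N : ℤ) ≤ 2400 * |p.1 - p.2|) ⊆
        (A ×ˢ A).filter fun p ↦ |p.1 - p.2| ≤ ((N / 2400 : ℕ) : ℤ) := by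
      refine Finset.monotone_filter_right _ fun p _ hp ↦ ?_
      push_cast
      omega
    have h2 := (Finset.card_le_card h1).trans (card_filter_product_near A (N / 2400))
    have h3 : A.card = 2 * N + 1 := by
      rw [hA, Int.card_Icc]
      omega
    have h4 : ((N / 2400 : ℕ) : ℝ) ≤ N / 2400 := by exact_mod_cast Nat.cast_div_le
    rw [h3] at h2
    calc _ ≤ (((2 * N + 1) * (2 * (N / 2400) + 1) : ℕ) : ℝ) := by exact_mod_cast h2
      _ ≤ (2 * N + 1) * (2 * (N / 2400) + 1) := by push_cast; gcongr
      _ ≤ _ := by nlinarith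
  have hmain : (N : ℝ) ^ 2 / 100 ≤ ‖∑ p ∈ A ×ˢ A, a p.1 * (starRingEnd ℂ) (a p.2)‖ := by
    rw [← hsq, Complex.norm_of_nonneg (by positivity)]
    nlinarith
  rw [← hsplit] at hmain
  have := hmain.trans (norm_add_le _ _)
  change _ ≤ ‖∑ p ∈ (A ×ˢ A).filter _, _‖
  linarith

lemma sum_eq_sum_blocks (ha0 : ∀ j ∉ Finset.Icc (-(N : ℤ)) N, a j = 0) :
    ∑ j ∈ Finset.Icc (-(N : ℤ)) N, a j =
      ∑ q ∈ blockIndices N, ∑ r ∈ blockResidues, a (5400 * q + r) := by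
  rw [← Finset.sum_product']
  have hinj : Set.InjOn (fun p : ℤ × ℤ ↦ 5400 * p.1 + p.2)
      (blockIndices N ×ˢ blockResidues : Finset (ℤ × ℤ)) := by
    rintro ⟨q, r⟩ h ⟨q', r'⟩ h' heq
    simp only [Finset.coe_product, Set.mem_prod, Finset.mem_coe, mem_blockResidues] at h h' heq
    ext <;> dsimp only <;> omega
  rw [← Finset.sum_image (f := a) hinj]
  refine Finset.sum_subset (fun j hj ↦ ?_) fun j _ hj ↦ ha0 j hj
  rw [Finset.mem_Icc] at hj
  refine Finset.mem_image.2 ⟨(j / 5400, j % 5400), ?_, by dsimp only; omega⟩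
  rw [Finset.mem_product, blockIndices, Finset.mem_Icc, mem_blockResidues]
  dsimp only
  omega

lemma le_sum_normSq_residuePairs (hN : 20000 ≤ N) (ha : ∀ j, ‖a j‖ ≤ 1)
    (ha0 : ∀ j ∉ Finset.Icc (-(N : ℤ)) N, a j = 0)
    (hsum : (N : ℝ) / 10 ≤ ‖∑ j ∈ Finset.Icc (-(N : ℤ)) N, a j‖) :
    (N : ℝ) ^ 2 / 360000 ≤ ∑ p ∈ residuePairs, ‖∑ q ∈ blockIndices N,
      a (5400 * q + p.1) * (starRingEnd ℂ) (a (5400 * q + p.2))‖ ^ 2 := by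
  have hN' : (20000 : ℝ) ≤ N := by exact_mod_cast hN
  set B := blockIndices N
  set I := blockResidues
  have hIcard : I.card = 5400 := card_blockResidues
  set G : ℤ × ℤ → ℂ := fun p ↦
    ∑ q ∈ B, a (5400 * q + p.1) * (starRingEnd ℂ) (a (5400 * q + p.2)) with hG
  have hBcard : (B.card : ℝ) ≤ N / 1800 := card_blockIndices_le hN
  have hGle (p : ℤ × ℤ) : ‖G p‖ ≤ B.card := by
    refine (norm_sum_le_of_le _ fun q _ ↦ norm_mul_conj_le_one ha _ _).trans_eq (by simp)
  have hCS : ‖∑ j ∈ Finset.Icc (-(N : ℤ)) N, a j‖ ^ 2 ≤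
      B.card * ∑ q ∈ B, ‖∑ r ∈ I, a (5400 * q + r)‖ ^ 2 := by
    rw [sum_eq_sum_blocks ha0]
    refine (pow_le_pow_left₀ (norm_nonneg _) (norm_sum_le _ _) 2).trans ?_
    exact sq_sum_le_card_mul_sum_sq
  have hexp : ((∑ q ∈ B, ‖∑ r ∈ I, a (5400 * q + r)‖ ^ 2 : ℝ) : ℂ) = ∑ p ∈ I ×ˢ I, G p := by
    rw [hG, Finset.sum_comm]
    push_cast
    refine Finset.sum_congr rfl fun q _ ↦ ?_
    rw [Finset.sum_product]
    simp only [← Finset.mul_sum]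
    rw [← Finset.sum_mul, ← map_sum, Complex.mul_conj']
  have hsplit := Finset.sum_filter_add_sum_filter_not (I ×ˢ I) (fun p ↦ 2 ≤ |p.1 - p.2|) G
  have hnear : ‖∑ p ∈ (I ×ˢ I).filter (fun p ↦ ¬ 2 ≤ |p.1 - p.2|), G p‖ ≤ 16200 * B.card := by
    refine (norm_sum_le_of_le _ fun p _ ↦ hGle p).trans ?_
    rw [Finset.sum_const, nsmul_eq_mul]
    have h1 : (I ×ˢ I).filter (fun p ↦ ¬ 2 ≤ |p.1 - p.2|) ⊆
        (I ×ˢ I).filter fun p ↦ |p.1 - p.2| ≤ ((1 : ℕ) : ℤ) := by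
      refine Finset.monotone_filter_right _ fun p _ hp ↦ ?_
      push_cast
      omega
    have h2 := (Finset.card_le_card h1).trans (card_filter_product_near I 1)
    rw [hIcard] at h2
    gcongr
    exact_mod_cast h2
  have hfar : ‖∑ p ∈ residuePairs, G p‖ ≤ ∑ p ∈ residuePairs, ‖G p‖ := norm_sum_le _ _
  have htot : ∑ q ∈ B, ‖∑ r ∈ I, a (5400 * q + r)‖ ^ 2 ≤
      ∑ p ∈ residuePairs, ‖G p‖ + 16200 * B.card := by
    have : ∑ q ∈ B, ‖∑ r ∈ I, a (5400 * q + r)‖ ^ 2 = ‖∑ p ∈ I ×ˢ I, G p‖ := by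
      rw [← hexp, Complex.norm_of_nonneg (by positivity)]
    rw [this, ← hsplit]
    exact (norm_add_le _ _).trans (add_le_add hfar hnear)
  have hlin : 9 * (N : ℝ) ≤ ∑ p ∈ residuePairs, ‖G p‖ := by
    set X := ∑ p ∈ residuePairs, ‖G p‖
    have hX : 0 ≤ X := by positivity
    have h1 : (N : ℝ) ^ 2 / 100 ≤ B.card * (X + 16200 * B.card) := by
      refine le_trans ?_ (hCS.trans (mul_le_mul_of_nonneg_left htot (Nat.cast_nonneg _)))
      nlinarith
    have h2 : (B.card : ℝ) * (X + 16200 * B.card) ≤ N / 1800 * (X + 16200 * (N / 1800)) := by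
      gcongr
    nlinarith
  have hcard := card_residuePairs_le
  have hCS2 : (∑ p ∈ residuePairs, ‖G p‖) ^ 2 ≤
      residuePairs.card * ∑ p ∈ residuePairs, ‖G p‖ ^ 2 := sq_sum_le_card_mul_sum_sq
  have hY : 0 ≤ ∑ p ∈ residuePairs, ‖G p‖ ^ 2 := by positivity
  change _ ≤ ∑ p ∈ residuePairs, ‖G p‖ ^ 2
  nlinarith

end combinatorics

/-- A nonnegative weight which is at least `1` on a ball of radius `ρ`, has integral comparable to
the area of the ball, and whose Fourier transform is supported at frequencies `O(1 / ρ)`. -/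
lemma exists_ball_weight : ∃ D : ℝ, 0 ≤ D ∧ ∀ (c : Plane) (ρ : ℝ), 0 < ρ →
    ∃ w : Plane → ℝ, Integrable w ∧ (∀ x, 0 ≤ w x) ∧ (∀ x ∈ Metric.ball c ρ, 1 ≤ w x) ∧
      ∫ x, w x = ρ ^ 2 * D ∧
      ∀ ω : ℝ × ℝ, 1 < ρ * |ω.1| ∨ 1 < ρ * |ω.2| → ∫ x, (w x : ℂ) * planeChar ω x = 0 := by
  obtain ⟨κ, hκ, hκ0, hκ1, hκω⟩ := exists_bandlimited_weight
  have hscale {E : Type} [NormedAddCommGroup E] [NormedSpace ℝ E] (c : Plane) {ρ : ℝ} (hρ : 0 < ρ)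
      (g : Plane → E) : ∫ x, g (ρ⁻¹ • (x - c)) = ρ ^ 2 • ∫ x, g x := by
    rw [integral_sub_right_eq_self (fun x ↦ g (ρ⁻¹ • x)) c, Measure.integral_comp_inv_smul,
      finrank_euclideanSpace_fin, abs_of_nonneg (by positivity)]
  refine ⟨∫ x, κ x, integral_nonneg hκ0, fun c ρ hρ ↦ ⟨fun x ↦ κ (ρ⁻¹ • (x - c)), ?_,
    fun x ↦ hκ0 _, fun x hx ↦ hκ1 _ ?_, hscale c hρ κ, fun ω hω ↦ ?_⟩⟩
  · exact (hκ.comp_smul (inv_ne_zero hρ.ne')).comp_sub_right c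
  · rw [mem_ball_iff_norm] at hx
    rw [norm_smul, norm_inv, Real.norm_of_nonneg hρ.le]
    exact (inv_mul_le_one₀ hρ).2 hx.le
  · have h (x : Plane) : (κ (ρ⁻¹ • (x - c)) : ℂ) * planeChar ω x =
        (κ (ρ⁻¹ • (x - c)) : ℂ) * planeChar (ρ • ω) (ρ⁻¹ • (x - c)) * planeChar ω c := by
      rw [mul_assoc]
      congr 1
      simp only [planeChar, ← Complex.exp_add]
      congr 1
      simp only [Prod.smul_fst, Prod.smul_snd, PiLp.smul_apply, PiLp.sub_apply, smul_eq_mul]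
      have : (ρ : ℂ) ≠ 0 := by exact_mod_cast hρ.ne'
      push_cast
      field_simp
      ring
    simp only [h]
    rw [hscale c hρ fun y ↦ (κ y : ℂ) * planeChar (ρ • ω) y * planeChar ω c, integral_mul_const,
      hκω (ρ • ω) (by simpa [abs_mul, abs_of_pos hρ] using hω)]
    simp

lemma HasSpectrumIn.integrable_mul_normSq {h : Plane → ℂ} {S : Set (ℝ × ℝ)}
    (hh : HasSpectrumIn h S) {w : Plane → ℝ} (hw : Integrable w) :
    Integrable fun x ↦ w x * ‖h x‖ ^ 2 := by
  obtain ⟨C, hC⟩ := hh.bounded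
  refine hw.mul_bdd (c := C ^ 2) (hh.1.norm.pow 2) (.of_forall fun x ↦ ?_)
  rw [norm_pow, norm_norm]
  exact pow_le_pow_left₀ (norm_nonneg _) (hC x) 2

section bilinear

variable {N : ℕ} {φ : ℤ → Plane → ℂ} {w : Plane → ℝ}

/-- Products over blocks of a fixed pair of residues are orthogonal at scale `N²`. -/
lemma integral_normSq_sum_blockIndices_le (hN : 20000 ≤ N)
    (hφ : ∀ j, HasSpectrumIn (φ j) (parabolaPiece N j)) (hb : ∀ j x, ‖φ j x‖ ≤ 1)
    (hw : Integrable w) (hw0 : ∀ x, 0 ≤ w x)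
    (hwω : ∀ ω : ℝ × ℝ, 1 < (N : ℝ) ^ 2 * |ω.1| ∨ 1 < (N : ℝ) ^ 2 * |ω.2| →
      ∫ x, (w x : ℂ) * planeChar ω x = 0) {r s : ℤ} (hrs : 2 ≤ |r - s|) :
    ∫ x, w x * ‖∑ q ∈ blockIndices N, φ (5400 * q + r) x *
      (starRingEnd ℂ) (φ (5400 * q + s) x)‖ ^ 2 ≤ N * ∫ x, w x := by
  have hN1 : 1 ≤ N := by omega
  have hN0 : (1 : ℝ) ≤ N := by exact_mod_cast hN1
  refine (integral_normSq_sum_mul_le (A := blockIndices N)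
    (S := fun q ↦ parabolaPiece N (5400 * q + r) - parabolaPiece N (5400 * q + s))
    (W := {ω | (N : ℝ) ^ 2 * |ω.1| ≤ 1 ∧ (N : ℝ) ^ 2 * |ω.2| ≤ 1})
    (R := (blockIndices N).image fun q ↦ (q, q)) hw hw0
    (fun ω hω ↦ hwω ω ?_) (fun q _ ↦ (hφ _).mul_conj (hφ _))
    (fun q _ x ↦ norm_mul_conj_le_one (a := fun j ↦ φ j x) (fun j ↦ hb j x) _ _) ?_).trans ?_
  · by_contra! h
    exact hω h
  · rintro q hq q' hq' ⟨z, hz, hz1, hz2⟩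
    have hrs' : (2 : ℝ) ≤ |(r : ℝ) - s| := by exact_mod_cast hrs
    have e1 : ((5400 * q + r : ℤ) : ℝ) - (5400 * q + s : ℤ) = r - s := by push_cast; ring
    have hNz : |N * z.1| ≤ 1 / (N : ℝ) := by
      rw [abs_mul, abs_of_nonneg (by positivity), le_div_iff₀ (by positivity)]
      linarith
    have hNz2 : |(N : ℝ) ^ 2 * z.2| ≤ 1 := by
      rwa [abs_mul, abs_of_nonneg (by positivity)]
    have := (sub_sub_parabolaPiece_bounds hN1 (by rw [e1]; linarith) hz hNz hNz2).2
    rw [e1, show ((5400 * q + r : ℤ) : ℝ) + (5400 * q + s : ℤ) -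
      ((5400 * q' + r : ℤ) + (5400 * q' + s : ℤ)) = 10800 * (q - q') by push_cast; ring,
      show 1 / (N : ℝ) * (4 * N) = 4 by field_simp, abs_mul,
      show |(10800 : ℝ)| = 10800 from abs_of_nonneg (by norm_num)] at this
    have hqq : q = q' := by
      by_contra hne
      have : (1 : ℝ) ≤ |(q : ℝ) - q'| := by
        exact_mod_cast Int.one_le_abs (sub_ne_zero.2 hne)
      nlinarith
    exact Finset.mem_image.2 ⟨q, hq, by rw [hqq]⟩
  · refine mul_le_mul_of_nonneg_right ?_ (integral_nonneg hw0)
    refine (Nat.cast_le.2 Finset.card_image_le).trans ((card_blockIndices_le hN).trans ?_)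
    linarith

/-- Products over far pairs are essentially orthogonal against a weight localised by products of
nearby pieces. -/
lemma integral_normSq_sum_farPairs_le (hN : 20000 ≤ N)
    (hφ : ∀ j, HasSpectrumIn (φ j) (parabolaPiece N j)) (hb : ∀ j x, ‖φ j x‖ ≤ 1)
    (hw : Integrable w) (hw0 : ∀ x, 0 ≤ w x)
    (hwω : ∀ ω : ℝ × ℝ, 10801 < N * |ω.1| ∨ 43217 * N < (N : ℝ) ^ 2 * |ω.2| →
      ∫ x, (w x : ℂ) * planeChar ω x = 0) :
    ∫ x, w x * ‖∑ p ∈ farPairs N, φ p.1 x * (starRingEnd ℂ) (φ p.2 x)‖ ^ 2 ≤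
      10 ^ 19 * (N : ℝ) ^ 2 * ∫ x, w x := by
  have hN1 : 1 ≤ N := by omega
  have hN0 : (20000 : ℝ) ≤ N := by exact_mod_cast hN
  set A := Finset.Icc (-(N : ℤ)) N with hA
  obtain ⟨M, hM⟩ : ∃ M : ℕ, M = 414897600 := ⟨_, rfl⟩
  set Q := (A ×ˢ A).filter fun p ↦ |p.1 - p.2| ≤ (M : ℤ) with hQ
  refine (integral_normSq_sum_mul_le (A := farPairs N)
    (h := fun p x ↦ φ p.1 x * (starRingEnd ℂ) (φ p.2 x))
    (S := fun p ↦ parabolaPiece N p.1 - parabolaPiece N p.2)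
    (W := {ω | N * |ω.1| ≤ 10801 ∧ (N : ℝ) ^ 2 * |ω.2| ≤ 43217 * N})
    (R := (Q ×ˢ Q).image fun p ↦ ((p.1.1, p.2.1), (p.1.2, p.2.2))) hw hw0
    (fun ω hω ↦ hwω ω ?_) (fun q _ ↦ (hφ _).mul_conj (hφ _))
    (fun q _ x ↦ norm_mul_conj_le_one (a := fun j ↦ φ j x) (fun j ↦ hb j x) _ _) ?_).trans ?_
  · by_contra! h
    exact hω h
  · rintro ⟨k, l⟩ hkl ⟨k', l'⟩ hkl' ⟨z, hz, hz1, hz2⟩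
    simp only [farPairs, Finset.mem_filter, Finset.mem_product] at hkl hkl'
    have hfar : (N : ℝ) ≤ 2400 * |(k : ℝ) - l| := by exact_mod_cast hkl.2
    have hNz : |N * z.1| ≤ (10801 : ℝ) := by
      rwa [abs_mul, abs_of_nonneg (by positivity)]
    have hNz2 : |(N : ℝ) ^ 2 * z.2| ≤ 43217 * N := by
      rwa [abs_mul, abs_of_nonneg (by positivity)]
    obtain ⟨h1, h2⟩ := sub_sub_parabolaPiece_bounds hN1 (by linarith) hz hNz hNz2
    have h3 : |((k : ℝ) + l) - (k' + l')| ≤ 414897602 := by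
      by_contra! h
      have h4 : (N : ℝ) / 4800 ≤ |(k : ℝ) - l| - 1 := by linarith
      have h5 : (N : ℝ) / 4800 * 414897600 ≤
          (|(k : ℝ) - l| - 1) * (|((k : ℝ) + l) - (k' + l')| - 2) :=
        mul_le_mul h4 (by linarith) (by norm_num) (by linarith)
      linarith
    have h4 : |(k - l) - (k' - l')| ≤ 10803 := by
      have : |((k : ℝ) - l) - (k' - l')| ≤ 10803 := by linarith
      exact_mod_cast this
    have h5 : |(k + l) - (k' + l')| ≤ 414897602 := by exact_mod_cast h3
    refine Finset.mem_image.2 ⟨((k, k'), (l, l')), ?_, rfl⟩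
    simp only [hQ, Finset.mem_product, Finset.mem_filter]
    rw [abs_le] at h4 h5
    refine ⟨⟨⟨hkl.1.1, hkl'.1.1⟩, abs_le.2 ?_⟩, ⟨hkl.1.2, hkl'.1.2⟩, abs_le.2 ?_⟩ <;>
    constructor <;> omega
  · refine mul_le_mul_of_nonneg_right ?_ (integral_nonneg hw0)
    have hcA : A.card = 2 * N + 1 := by
      rw [hA, Int.card_Icc]
      omega
    have hcQ : (Q.card : ℝ) ≤ (2 * N + 1) * (2 * M + 1) := by
      exact_mod_cast (card_filter_product_near A M).trans_eq (by rw [hcA])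
    have hcQ' : (Q.card : ℝ) ≤ 3 * 10 ^ 9 * N := by
      refine hcQ.trans ?_
      rw [hM]
      norm_num
      linarith
    refine (Nat.cast_le.2 Finset.card_image_le).trans ?_
    rw [Finset.card_product]
    push_cast
    nlinarith [Nat.cast_nonneg (α := ℝ) Q.card]

lemma hasSpectrumIn_sum_blockIndices (hN : 1 ≤ N)
    (hφ : ∀ j, HasSpectrumIn (φ j) (parabolaPiece N j)) {p : ℤ × ℤ} (hp : p ∈ residuePairs) :
    HasSpectrumIn (fun x ↦ ∑ q ∈ blockIndices N, φ (5400 * q + p.1) x *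
      (starRingEnd ℂ) (φ (5400 * q + p.2) x))
      {s | |N * s.1| ≤ 5400 ∧ |(N : ℝ) ^ 2 * s.2| ≤ 21608 * N} := by
  refine .sum fun q _ ↦ ((hφ _).mul_conj (hφ _)).mono fun s hs ↦ ?_
  simp only [residuePairs, Finset.mem_filter, Finset.mem_product, mem_blockResidues] at hp
  have hK : |((5400 * q + p.1 : ℤ) : ℝ) - (5400 * q + p.2 : ℤ)| + 1 ≤ 5400 := by
    have : |(5400 * q + p.1) - (5400 * q + p.2)| + 1 ≤ 5400 := by
      rw [add_sub_add_left_eq_sub, Int.add_one_le_iff, abs_lt]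
      omega
    exact_mod_cast this
  obtain ⟨h1, h2⟩ := sub_parabolaPiece_bounds hN hK hs
  exact ⟨h1, h2.trans_eq (by norm_num)⟩

lemma integral_normSq_mul_normSq_le (hN : 20000 ≤ N)
    (hφ : ∀ j, HasSpectrumIn (φ j) (parabolaPiece N j)) (hb : ∀ j x, ‖φ j x‖ ≤ 1)
    (hw : Integrable w) (hw0 : ∀ x, 0 ≤ w x)
    (hwω : ∀ ω : ℝ × ℝ, 1 < (N : ℝ) ^ 2 * |ω.1| ∨ 1 < (N : ℝ) ^ 2 * |ω.2| →
      ∫ x, (w x : ℂ) * planeChar ω x = 0) {p : ℤ × ℤ} (hp : p ∈ residuePairs) :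
    ∫ x, w x * ‖∑ q ∈ blockIndices N, φ (5400 * q + p.1) x *
        (starRingEnd ℂ) (φ (5400 * q + p.2) x)‖ ^ 2 *
        ‖∑ p ∈ farPairs N, φ p.1 x * (starRingEnd ℂ) (φ p.2 x)‖ ^ 2 ≤
      10 ^ 19 * (N : ℝ) ^ 3 * ∫ x, w x := by
  have hN1 : 1 ≤ N := by omega
  have hN0 : (1 : ℝ) ≤ N := by exact_mod_cast hN1
  have hG := hasSpectrumIn_sum_blockIndices hN1 hφ hp
  refine (integral_normSq_sum_farPairs_le hN hφ hb (hG.integrable_mul_normSq hw)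
    (fun x ↦ mul_nonneg (hw0 x) (sq_nonneg _)) fun ω hω ↦ ?_).trans ?_
  · have := (hG.mul_conj hG).integral_mul_planeChar_eq_zero hw.ofReal (ω := ω) ?_
    · refine Eq.trans ?_ this
      congr 1
      ext x
      rw [Complex.mul_conj']
      push_cast
      rfl
    · rintro _ ⟨s, ⟨hs1, hs2⟩, t, ⟨ht1, ht2⟩, rfl⟩
      refine hwω _ (hω.imp (fun h ↦ ?_) fun h ↦ ?_)
      · have : N * |ω.1| ≤ N * |(ω + (s - t)).1| + |N * s.1| + |N * t.1| := by
          simp only [abs_mul, Nat.abs_cast, ← mul_add]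
          gcongr
          calc |ω.1| = |(ω + (s - t)).1 + (-s.1) + t.1| := by
                simp only [Prod.fst_add, Prod.fst_sub]
                congr 1
                ring
            _ ≤ _ := (abs_add_three _ _ _).trans_eq (by rw [abs_neg])
        nlinarith
      · have : (N : ℝ) ^ 2 * |ω.2| ≤
            (N : ℝ) ^ 2 * |(ω + (s - t)).2| + |(N : ℝ) ^ 2 * s.2| + |(N : ℝ) ^ 2 * t.2| := by
          simp only [abs_mul, abs_pow, Nat.abs_cast, ← mul_add]
          gcongr
          calc |ω.2| = |(ω + (s - t)).2 + (-s.2) + t.2| := by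
                simp only [Prod.snd_add, Prod.snd_sub]
                congr 1
                ring
            _ ≤ _ := (abs_add_three _ _ _).trans_eq (by rw [abs_neg])
        linarith
  · have h2 : 2 ≤ |p.1 - p.2| := (Finset.mem_filter.1 hp).2
    calc _ ≤ 10 ^ 19 * (N : ℝ) ^ 2 * (N * ∫ x, w x) := by
          gcongr
          exact integral_normSq_sum_blockIndices_le hN hφ hb hw hw0 hwω h2
      _ = _ := by ring

/-- The measure of the set where a sum of functions bounded by `1` with spectra in the pieces of
the parabola is nearly extremal. -/
lemma exists_volume_superlevel_le : ∃ C : ℝ, 0 ≤ C ∧ ∀ (N : ℕ), 20000 ≤ N →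
    ∀ φ : ℤ → Plane → ℂ, (∀ j, HasSpectrumIn (φ j) (parabolaPiece N j)) →
    (∀ j x, ‖φ j x‖ ≤ 1) → (∀ j ∉ Finset.Icc (-(N : ℤ)) N, ∀ x, φ j x = 0) → ∀ c : Plane,
    volume {x | x ∈ Metric.ball c ((N : ℝ) ^ 2) ∧
      (N : ℝ) / 10 < ‖∑ j ∈ Finset.Icc (-(N : ℤ)) N, φ j x‖} ≤ ENNReal.ofReal (C * N) := by
  obtain ⟨D, hD, hball⟩ := exists_ball_weight
  refine ⟨10 ^ 19 * 5400 ^ 2 * (360000 * 40000) * D, by positivity,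
    fun N hN φ hφ hb hφ0 c ↦ ?_⟩
  have hN1 : (1 : ℝ) ≤ N := by exact_mod_cast (by omega : 1 ≤ N)
  obtain ⟨w, hw, hw0, hw1, hwD, hwω⟩ := hball c ((N : ℝ) ^ 2) (by positivity)
  set F : Plane → ℂ := fun x ↦ ∑ p ∈ farPairs N, φ p.1 x * (starRingEnd ℂ) (φ p.2 x)
  set G : ℤ × ℤ → Plane → ℂ := fun p x ↦ ∑ q ∈ blockIndices N, φ (5400 * q + p.1) x *
    (starRingEnd ℂ) (φ (5400 * q + p.2) x)
  set Φ : Plane → ℝ := fun x ↦ ∑ p ∈ residuePairs, w x * ‖G p x‖ ^ 2 * ‖F x‖ ^ 2 with hΦ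
  set t : ℝ := (N : ℝ) ^ 2 / 360000 * ((N : ℝ) ^ 4 / 40000) with ht
  have ht0 : 0 < t := by positivity
  have hFs : HasSpectrumIn F Set.univ :=
    .sum fun p _ ↦ ((hφ _).mul_conj (hφ _)).mono (Set.subset_univ _)
  have hint (p : ℤ × ℤ) (hp : p ∈ residuePairs) :
      Integrable fun x ↦ w x * ‖G p x‖ ^ 2 * ‖F x‖ ^ 2 :=
    hFs.integrable_mul_normSq
      ((hasSpectrumIn_sum_blockIndices (by omega) hφ hp).integrable_mul_normSq hw)
  have hΦint : Integrable Φ := integrable_finsetSum _ hint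
  have hΦ0 (x : Plane) : 0 ≤ Φ x := Finset.sum_nonneg fun p _ ↦
    mul_nonneg (mul_nonneg (hw0 x) (sq_nonneg _)) (sq_nonneg _)
  have hΦle : ∫ x, Φ x ≤ 5400 ^ 2 * (10 ^ 19 * (N : ℝ) ^ 3 * ((N : ℝ) ^ 4 * D)) := by
    rw [hΦ, integral_finsetSum _ hint]
    refine (Finset.sum_le_card_nsmul _ _ _ fun p hp ↦
      integral_normSq_mul_normSq_le hN hφ hb hw hw0 hwω hp).trans ?_
    rw [nsmul_eq_mul, hwD, ← pow_mul]
    exact mul_le_mul_of_nonneg_right card_residuePairs_le (by positivity)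
  have hsub : {x | x ∈ Metric.ball c ((N : ℝ) ^ 2) ∧
      (N : ℝ) / 10 < ‖∑ j ∈ Finset.Icc (-(N : ℤ)) N, φ j x‖} ⊆ {x | t ≤ Φ x} := by
    rintro x ⟨hxc, hx⟩
    have h1 : (N : ℝ) ^ 2 / 360000 ≤ ∑ p ∈ residuePairs, ‖G p x‖ ^ 2 :=
      le_sum_normSq_residuePairs (a := fun j ↦ φ j x) hN (fun j ↦ hb j x)
        (fun j hj ↦ hφ0 j hj x) hx.le
    have h2 : (N : ℝ) ^ 2 / 200 ≤ ‖F x‖ :=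
      le_norm_sum_farPairs (a := fun j ↦ φ j x) hN (fun j ↦ hb j x) hx.le
    have h3 : (N : ℝ) ^ 4 / 40000 ≤ ‖F x‖ ^ 2 := by
      refine le_trans (le_of_eq ?_) (pow_le_pow_left₀ (by positivity) h2 2)
      ring
    have h4 : Φ x = w x * (∑ p ∈ residuePairs, ‖G p x‖ ^ 2) * ‖F x‖ ^ 2 := by
      rw [Finset.mul_sum, Finset.sum_mul]
    change t ≤ Φ x
    rw [h4, ht]
    generalize ∑ p ∈ residuePairs, ‖G p x‖ ^ 2 = Y at h1 ⊢
    have h5 : 0 ≤ Y := le_trans (by positivity) h1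
    have h6 : Y ≤ w x * Y := le_mul_of_one_le_left h5 (hw1 x hxc)
    exact mul_le_mul (h1.trans h6) h3 (by positivity) (h5.trans h6)
  have hfin : volume {x | t ≤ Φ x} ≠ ⊤ := (hΦint.measure_ge_lt_top ht0).ne
  refine (measure_mono hsub).trans ?_
  rw [← ENNReal.ofReal_toReal hfin]
  refine ENNReal.ofReal_le_ofReal ?_
  have hcheb := (mul_meas_ge_le_integral_of_nonneg (.of_forall hΦ0) hΦint t).trans hΦle
  refine le_of_mul_le_mul_left (hcheb.trans_eq ?_) ht0
  rw [ht]
  ring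

end bilinear

end

/-- Sharp level-set bound from decoupling: if `f` has Fourier support in the
`N⁻²`-neighborhood of the truncated parabola and `‖f_{θ_j}‖_∞ ≤ 1` for every `j`, then the
superlevel set `{x ∈ B_{N²} : |f(x)| > N/10}` has measure at most `C_ε N^{1+ε}`. -/
theorem level_set_bound_parabola (ε : ℝ) (hε : 0 < ε) :
    ∃ C : ℝ, ∀ N : ℕ, 1 ≤ N → ∀ f : SchwartzMap (EuclideanSpace ℝ (Fin 2)) ℂ,
      (∀ ω : ℝ × ℝ, ω ∉ parabolaNbhd N → fourierTransformE f ω = 0) →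
      (∀ j ∈ Finset.Icc (-(N : ℤ)) N, ∀ x : EuclideanSpace ℝ (Fin 2),
        ‖fourierPieceE f (parabolaPiece N j) x‖ ≤ 1) →
      ∀ c : EuclideanSpace ℝ (Fin 2),
      volume {x : EuclideanSpace ℝ (Fin 2) |
          x ∈ Metric.ball c ((N : ℝ) ^ 2) ∧ ‖f x‖ > (N : ℝ) / 10}
        ≤ ENNReal.ofReal (C * (N : ℝ) ^ ((1 : ℝ) + ε)) := by
  obtain ⟨C, hC, hmain⟩ := exists_volume_superlevel_le
  set V := volume.real (Metric.ball (0 : Plane) 1)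
  have hV0 : 0 ≤ V := measureReal_nonneg
  refine ⟨C + 20000 ^ 4 * V, fun N hN f hf hb c ↦ ?_⟩
  have hN1 : (1 : ℝ) ≤ N := by exact_mod_cast hN
  have hpow : (N : ℝ) ≤ (N : ℝ) ^ ((1 : ℝ) + ε) := by
    simpa using Real.rpow_le_rpow_of_exponent_le hN1 (by linarith : (1 : ℝ) ≤ 1 + ε)
  rcases lt_or_ge N 20000 with hlt | hge
  · have hN2 : (N : ℝ) ≤ 20000 := by exact_mod_cast hlt.le
    refine (measure_mono (t := Metric.ball c ((N : ℝ) ^ 2)) fun x hx ↦ hx.1).trans ?_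
    rw [Measure.addHaar_ball _ c (by positivity), finrank_euclideanSpace_fin,
      ← ENNReal.ofReal_toReal (measure_ball_lt_top (μ := volume) (x := (0 : Plane))).ne,
      ← ENNReal.ofReal_mul (by positivity)]
    refine ENNReal.ofReal_le_ofReal ?_
    change ((N : ℝ) ^ 2) ^ 2 * V ≤ _
    calc ((N : ℝ) ^ 2) ^ 2 * V ≤ (20000 ^ 2) ^ 2 * V := by gcongr
      _ ≤ (C + 20000 ^ 4 * V) * 1 := by linarith
      _ ≤ _ := by gcongr; exact hN1.trans hpow
  · set A := Finset.Icc (-(N : ℤ)) N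
    set φ : ℤ → Plane → ℂ := fun j ↦
      if j ∈ A then fourierPieceE f (parabolaPiece N j) else fun _ ↦ 0
    have hφA (j : ℤ) (hj : j ∈ A) : φ j = fourierPieceE f (parabolaPiece N j) := if_pos hj
    have hφA' (j : ℤ) (hj : j ∉ A) : φ j = fun _ ↦ 0 := if_neg hj
    have hsum (x : Plane) : ∑ j ∈ A, φ j x = f x := by
      rw [← sum_fourierPieceE (by omega) hf x]
      exact Finset.sum_congr rfl fun j hj ↦ by rw [hφA j hj]
    have := hmain N hge φ (fun j ↦ ?_) (fun j x ↦ ?_) (fun j hj x ↦ by rw [hφA' j hj]) c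
    · simp only [A, hsum] at this
      refine this.trans (ENNReal.ofReal_le_ofReal ?_)
      have : 0 ≤ 20000 ^ 4 * V := by positivity
      gcongr
      linarith
    · by_cases hj : j ∈ A
      · rw [hφA j hj]
        exact hasSpectrumIn_fourierPieceE hf j
      · rw [hφA' j hj]
        exact .zero _
    · by_cases hj : j ∈ A
      · rw [hφA j hj]
        exact hb j hj x
      · rw [hφA' j hj]
        simp
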